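/- A lightcone framed curve (γ,ℓ⁺,ℓ⁻) : I → ℝ³₁ × Δ₄ with lightcone curvature (κ₁,κ₂,κ₃,α,β) is an (ℓ⁺,ℓ̄⁻)-Bertrand lightcone framed curve if and only if there exist smooth functions λ, k : I → ℝ with λ ≢ 0 such that k(t)β(t) = λ(t)κ₃(t) for all t ∈ I; consequently, (γ,ℓ⁺,ℓ⁻) is an (ℓ⁺,ℓ̄⁺)-Bertrand lightcone framed curve if and only if it is an (ℓ⁺,ℓ̄⁻)-Bertrand lightcone framed curve. -/

import Mathlib

open Matrix

noncomputable section

/-- The Minkowski pseudo-scalar product on `ℝ³`: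
`⟨x,y⟩ = −x₁y₁ + x₂y₂ + x₃y₃`. -/
def mdot (x y : Fin 3 → ℝ) : ℝ := -(x 0 * y 0) + x 1 * y 1 + x 2 * y 2

/-- The pseudo vector product `x ∧ y` on Minkowski `ℝ³`, i.e. the determinant of the
matrix with rows `(−e₁, e₂, e₃)`, `x`, `y`. -/
def mcross (x y : Fin 3 → ℝ) : Fin 3 → ℝ :=
  ![-(x 1 * y 2 - x 2 * y 1), x 2 * y 0 - x 0 * y 2, x 0 * y 1 - x 1 * y 0]

/-- The (punctured) lightcone `LC* = {x ≠ 0 : ⟨x,x⟩ = 0}`. -/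
def LCstar (x : Fin 3 → ℝ) : Prop := x ≠ 0 ∧ mdot x x = 0

/-- Membership in `Δ₄ = {(v,w) ∈ LC* × LC* : ⟨v,w⟩ = −2}`. -/
def MemDelta4 (v w : Fin 3 → ℝ) : Prop := LCstar v ∧ LCstar w ∧ mdot v w = -2

/-- `n(t) = −(1/2) ℓ⁺(t) ∧ ℓ⁻(t)`. -/
def lcn (lp lm : ℝ → Fin 3 → ℝ) : ℝ → Fin 3 → ℝ :=
  fun t => (-(1/2) : ℝ) • mcross (lp t) (lm t)

/-- Smoothness (on `I`) of a real valued function. -/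
def Smooth1 (I : Set ℝ) (f : ℝ → ℝ) : Prop := ContDiffOn ℝ (⊤ : ℕ∞) f I

/-- Smoothness (on `I`) of an `ℝ³`-valued function. -/
def Smooth3 (I : Set ℝ) (f : ℝ → Fin 3 → ℝ) : Prop := ContDiffOn ℝ (⊤ : ℕ∞) f I

/-- `λ ≢ 0` : the set where `λ` is non-zero is dense in `I`. -/
def NotIdentZero (I : Set ℝ) (f : ℝ → ℝ) : Prop :=
  I ⊆ closure {t | t ∈ I ∧ f t ≠ 0}

/-- A lightcone framed curve `(γ, ℓ⁺, ℓ⁻) : I → ℝ³₁ × Δ₄`. -/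
structure IsLightconeFramedCurve (I : Set ℝ) (γ lp lm : ℝ → Fin 3 → ℝ) : Prop where
  smooth_base : Smooth3 I γ
  smooth_lp : Smooth3 I lp
  smooth_lm : Smooth3 I lm
  delta4 : ∀ t ∈ I, MemDelta4 (lp t) (lm t)
  exists_coeffs : ∃ α β : ℝ → ℝ, Smooth1 I α ∧ Smooth1 I β ∧
    ∀ t ∈ I, deriv γ t = α t • lp t + β t • lm t

/-- `(κ₁, κ₂, κ₃, α, β)` is the lightcone curvature of the lightcone framed curve
`(γ, ℓ⁺, ℓ⁻)`. -/
structure HasLightconeCurvature (I : Set ℝ) (γ lp lm : ℝ → Fin 3 → ℝ)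
    (κ₁ κ₂ κ₃ α β : ℝ → ℝ) : Prop where
  smooth_κ₁ : Smooth1 I κ₁
  smooth_κ₂ : Smooth1 I κ₂
  smooth_κ₃ : Smooth1 I κ₃
  smooth_α : Smooth1 I α
  smooth_β : Smooth1 I β
  deriv_lp : ∀ t ∈ I, deriv lp t = κ₁ t • lp t + (2 * κ₃ t) • lcn lp lm t
  deriv_lm : ∀ t ∈ I, deriv lm t = (-κ₁ t) • lm t + (2 * κ₂ t) • lcn lp lm t
  deriv_n : ∀ t ∈ I, deriv (lcn lp lm) t = κ₂ t • lp t + κ₃ t • lm t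
  deriv_base : ∀ t ∈ I, deriv γ t = α t • lp t + β t • lm t

/-- The vector field `ℓ⁺` built from a lightcone frame. -/
def fieldLp (lp lm : ℝ → Fin 3 → ℝ) : ℝ → Fin 3 → ℝ := fun t => lp t
/-- The vector field `ℓ⁻` built from a lightcone frame. -/
def fieldLm (lp lm : ℝ → Fin 3 → ℝ) : ℝ → Fin 3 → ℝ := fun t => lm t
/-- `nᵀ = (ℓ⁺ + ℓ⁻)/2`. -/
def fieldNT (lp lm : ℝ → Fin 3 → ℝ) : ℝ → Fin 3 → ℝ := fun t => (1/2 : ℝ) • (lp t + lm t)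
/-- `nˢ = (ℓ⁺ − ℓ⁻)/2`. -/
def fieldNS (lp lm : ℝ → Fin 3 → ℝ) : ℝ → Fin 3 → ℝ := fun t => (1/2 : ℝ) • (lp t - lm t)
/-- `n = −(1/2) ℓ⁺ ∧ ℓ⁻`. -/
def fieldN (lp lm : ℝ → Fin 3 → ℝ) : ℝ → Fin 3 → ℝ := lcn lp lm
/-- `ℓ̃⁺ = nᵀ + n`. -/
def fieldLtp (lp lm : ℝ → Fin 3 → ℝ) : ℝ → Fin 3 → ℝ :=
  fun t => fieldNT lp lm t + fieldN lp lm t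
/-- `ℓ̃⁻ = nᵀ − n`. -/
def fieldLtm (lp lm : ℝ → Fin 3 → ℝ) : ℝ → Fin 3 → ℝ :=
  fun t => fieldNT lp lm t - fieldN lp lm t

/-- `(γ,ℓ⁺,ℓ⁻)` and `(γ̄,ℓ̄⁺,ℓ̄⁻)` are `(v,w̄)`-mates. -/
def AreMates (I : Set ℝ)
    (v w : (ℝ → Fin 3 → ℝ) → (ℝ → Fin 3 → ℝ) → ℝ → Fin 3 → ℝ)
    (γ lp lm γ' lp' lm' : ℝ → Fin 3 → ℝ) : Prop :=
  IsLightconeFramedCurve I γ lp lm ∧ IsLightconeFramedCurve I γ' lp' lm' ∧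
  ∃ lam : ℝ → ℝ, Smooth1 I lam ∧ NotIdentZero I lam ∧
    (∀ t ∈ I, γ' t = γ t + lam t • v lp lm t) ∧
    (∀ t ∈ I, v lp lm t = w lp' lm' t)

/-- `(γ,ℓ⁺,ℓ⁻)` is a `(v,w̄)`-Bertrand lightcone framed curve. -/
def IsBertrand (I : Set ℝ)
    (v w : (ℝ → Fin 3 → ℝ) → (ℝ → Fin 3 → ℝ) → ℝ → Fin 3 → ℝ)
    (γ lp lm : ℝ → Fin 3 → ℝ) : Prop :=
  ∃ γ' lp' lm' : ℝ → Fin 3 → ℝ, AreMates I v w γ lp lm γ' lp' lm'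

lemma mdot_comm (x y : Fin 3 → ℝ) : mdot x y = mdot y x := by
  simp only [mdot]; ring

lemma mdot_add_left (x y z : Fin 3 → ℝ) : mdot (x + y) z = mdot x z + mdot y z := by
  simp only [mdot, Pi.add_apply]; ring

lemma mdot_smul_left (a : ℝ) (x y : Fin 3 → ℝ) : mdot (a • x) y = a * mdot x y := by
  simp only [mdot, Pi.smul_apply, smul_eq_mul]; ring

lemma mdot_add_right (x y z : Fin 3 → ℝ) : mdot x (y + z) = mdot x y + mdot x z := by
  simp only [mdot, Pi.add_apply]; ring

lemma mdot_smul_right (a : ℝ) (x y : Fin 3 → ℝ) : mdot x (a • y) = a * mdot x y := by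
  simp only [mdot, Pi.smul_apply, smul_eq_mul]; ring

lemma mdot_mcross_left (x y : Fin 3 → ℝ) : mdot (mcross x y) x = 0 := by
  simp [mdot, mcross]; ring

lemma mdot_mcross_right (x y : Fin 3 → ℝ) : mdot (mcross x y) y = 0 := by
  simp [mdot, mcross]; ring

lemma mdot_mcross_self (x y : Fin 3 → ℝ) :
    mdot (mcross x y) (mcross x y) = mdot x y ^ 2 - mdot x x * mdot y y := by
  simp [mdot, mcross]; ring

lemma mdot_lcn_lp (lp lm : ℝ → Fin 3 → ℝ) (t : ℝ) : mdot (lcn lp lm t) (lp t) = 0 := by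
  simp only [lcn, mdot_smul_left, mdot_mcross_left, mul_zero]

lemma mdot_lcn_lm (lp lm : ℝ → Fin 3 → ℝ) (t : ℝ) : mdot (lcn lp lm t) (lm t) = 0 := by
  simp only [lcn, mdot_smul_left, mdot_mcross_right, mul_zero]

lemma mdot_lcn_self {lp lm : ℝ → Fin 3 → ℝ} {t : ℝ} (h : MemDelta4 (lp t) (lm t)) :
    mdot (lcn lp lm t) (lcn lp lm t) = 1 := by
  simp only [lcn, mdot_smul_left, mdot_smul_right, mdot_mcross_self, h.2.2, h.1.2]
  norm_num

lemma Smooth3.coord {I : Set ℝ} {f : ℝ → Fin 3 → ℝ} (hf : Smooth3 I f) (i : Fin 3) :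
    ContDiffOn ℝ (⊤ : ℕ∞) (fun t => f t i) I :=
  contDiffOn_pi.1 hf i

lemma Smooth3.mdot {I : Set ℝ} {f g : ℝ → Fin 3 → ℝ} (hf : Smooth3 I f) (hg : Smooth3 I g) :
    Smooth1 I (fun t => mdot (f t) (g t)) :=
  (((hf.coord 0).mul (hg.coord 0)).neg.add ((hf.coord 1).mul (hg.coord 1))).add
    ((hf.coord 2).mul (hg.coord 2))

lemma Smooth3.lcn {I : Set ℝ} {f g : ℝ → Fin 3 → ℝ} (hf : Smooth3 I f) (hg : Smooth3 I g) :
    Smooth3 I (lcn f g) := by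
  refine ContDiffOn.const_smul _ (contDiffOn_pi.2 fun i => ?_)
  fin_cases i
  · exact (((hf.coord 1).mul (hg.coord 2)).sub ((hf.coord 2).mul (hg.coord 1))).neg
  · exact ((hf.coord 2).mul (hg.coord 0)).sub ((hf.coord 0).mul (hg.coord 2))
  · exact ((hf.coord 0).mul (hg.coord 1)).sub ((hf.coord 1).mul (hg.coord 0))

lemma MemDelta4.symm {v w : Fin 3 → ℝ} (h : MemDelta4 v w) : MemDelta4 w v :=
  ⟨h.2.1, h.1, (mdot_comm w v).trans h.2.2⟩

/-- Exchanging the two lightlike fields of a lightcone framed curve gives another one. -/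
lemma IsLightconeFramedCurve.swap {I : Set ℝ} {γ lp lm : ℝ → Fin 3 → ℝ}
    (h : IsLightconeFramedCurve I γ lp lm) : IsLightconeFramedCurve I γ lm lp where
  smooth_base := h.smooth_base
  smooth_lp := h.smooth_lm
  smooth_lm := h.smooth_lp
  delta4 t ht := (h.delta4 t ht).symm
  exists_coeffs := by
    obtain ⟨α, β, hα, hβ, hd⟩ := h.exists_coeffs
    exact ⟨β, α, hβ, hα, fun t ht => (hd t ht).trans (add_comm _ _)⟩

lemma isBertrand_lp_lp_iff_lp_lm {I : Set ℝ} {γ lp lm : ℝ → Fin 3 → ℝ} :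
    IsBertrand I fieldLp fieldLp γ lp lm ↔ IsBertrand I fieldLp fieldLm γ lp lm :=
  ⟨fun ⟨γ', lp', lm', h, h', hl⟩ => ⟨γ', lm', lp', h, h'.swap, hl⟩,
    fun ⟨γ', lp', lm', h, h', hl⟩ => ⟨γ', lm', lp', h, h'.swap, hl⟩⟩

/-- The velocity of the curve `γ + λ ℓ⁺`, in the frame `(ℓ⁺, ℓ⁻, n)`. -/
lemma HasLightconeCurvature.deriv_add_smul_lp {I : Set ℝ} (hI : IsOpen I)
    {γ lp lm : ℝ → Fin 3 → ℝ} {κ₁ κ₂ κ₃ α β lam : ℝ → ℝ}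
    (hF : IsLightconeFramedCurve I γ lp lm)
    (hC : HasLightconeCurvature I γ lp lm κ₁ κ₂ κ₃ α β) (hlam : Smooth1 I lam)
    {t : ℝ} (ht : t ∈ I) :
    deriv (fun s => γ s + lam s • lp s) t =
      (α t + deriv lam t + lam t * κ₁ t) • lp t + β t • lm t
        + (2 * (lam t * κ₃ t)) • lcn lp lm t := by
  have hn : I ∈ nhds t := hI.mem_nhds ht
  have hγ : HasDerivAt γ (deriv γ t) t :=
    ((hF.smooth_base.contDiffAt hn).differentiableAt (by simp)).hasDerivAt
  have hlp : HasDerivAt lp (deriv lp t) t :=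
    ((hF.smooth_lp.contDiffAt hn).differentiableAt (by simp)).hasDerivAt
  have hl : HasDerivAt lam (deriv lam t) t :=
    ((hlam.contDiffAt hn).differentiableAt (by simp)).hasDerivAt
  refine (hγ.add (hl.smul hlp)).deriv.trans ?_
  rw [hC.deriv_base t ht, hC.deriv_lp t ht]
  module

/-- Rotating the lightlike frame by a lightlike rotation that fixes `ℓ⁺`. -/
lemma memDelta4_parabolic {lp lm : ℝ → Fin 3 → ℝ} {t : ℝ} (h : MemDelta4 (lp t) (lm t))
    (k : ℝ) :
    MemDelta4 (k ^ 2 • lp t + lm t + (2 * k) • lcn lp lm t) (lp t) := by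
  have hpp := h.1.2
  have hmm := h.2.1.2
  have hpm := h.2.2
  have hmp := h.symm.2.2
  have hnp := mdot_lcn_lp lp lm t
  have hnm := mdot_lcn_lm lp lm t
  have hpn := (mdot_comm _ _).trans hnp
  have hmn := (mdot_comm _ _).trans hnm
  have hnn := mdot_lcn_self h
  have hw : mdot (k ^ 2 • lp t + lm t + (2 * k) • lcn lp lm t) (lp t) = -2 := by
    simp only [mdot_add_left, mdot_smul_left, hpp, hmp, hnp]
    ring
  refine ⟨⟨fun h0 => ?_, ?_⟩, h.1, hw⟩
  · rw [h0] at hw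
    simp [mdot] at hw
  · simp only [mdot_add_left, mdot_smul_left, mdot_add_right, mdot_smul_right, hpp, hmm, hpm,
      hmp, hnp, hnm, hpn, hmn, hnn]
    ring

lemma exists_of_isBertrand_lp_lm {I : Set ℝ} (hI : IsOpen I)
    {γ lp lm : ℝ → Fin 3 → ℝ} {κ₁ κ₂ κ₃ α β : ℝ → ℝ}
    (hC : HasLightconeCurvature I γ lp lm κ₁ κ₂ κ₃ α β)
    (h : IsBertrand I fieldLp fieldLm γ lp lm) :
    ∃ lam k : ℝ → ℝ, Smooth1 I lam ∧ Smooth1 I k ∧ NotIdentZero I lam ∧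
      ∀ t ∈ I, k t * β t = lam t * κ₃ t := by
  obtain ⟨γ', lp', lm', hF, hF', lam, hlam, hnz, hγ', hlm'⟩ := h
  obtain ⟨A, B, -, -, hd⟩ := hF'.exists_coeffs
  refine ⟨lam, fun t => (1 / 2 : ℝ) * mdot (lp' t) (lcn lp lm t), hlam,
    contDiffOn_const.mul (hF'.smooth_lp.mdot (hF.smooth_lp.lcn hF.smooth_lm)), hnz,
    fun t ht => ?_⟩
  have hv : deriv γ' t = deriv (fun s => γ s + lam s • lp s) t :=
    Filter.EventuallyEq.deriv_eq (Filter.eventually_of_mem (hI.mem_nhds ht) hγ')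
  have hl : lp t = lm' t := hlm' t ht
  rw [hd t ht, hC.deriv_add_smul_lp hI hF hlam ht, ← hl] at hv
  have hΔ := hF.delta4 t ht
  have hΔ' := (hF'.delta4 t ht).2.2
  rw [← hl] at hΔ'
  have hnp := mdot_lcn_lp lp lm t
  have hnm := mdot_lcn_lm lp lm t
  have e₁ := congrArg (fun x => mdot x (lp t)) hv
  have e₂ := congrArg (fun x => mdot x (lcn lp lm t)) hv
  simp only [mdot_add_left, mdot_smul_left, hΔ', hΔ.1.2, hΔ.symm.2.2, hnp] at e₁
  simp only [mdot_add_left, mdot_smul_left, mdot_lcn_self hΔ, (mdot_comm _ _).trans hnp,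
    (mdot_comm _ _).trans hnm] at e₂
  have hA : A t = β t := by linarith
  rw [hA] at e₂
  simp only
  linarith

lemma isBertrand_lp_lm_of_exists {I : Set ℝ} (hI : IsOpen I)
    {γ lp lm : ℝ → Fin 3 → ℝ} {κ₁ κ₂ κ₃ α β lam k : ℝ → ℝ}
    (hF : IsLightconeFramedCurve I γ lp lm)
    (hC : HasLightconeCurvature I γ lp lm κ₁ κ₂ κ₃ α β)
    (hlam : Smooth1 I lam) (hk : Smooth1 I k) (hnz : NotIdentZero I lam)
    (h : ∀ t ∈ I, k t * β t = lam t * κ₃ t) :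
    IsBertrand I fieldLp fieldLm γ lp lm := by
  refine ⟨fun t => γ t + lam t • lp t,
    fun t => k t ^ 2 • lp t + lm t + (2 * k t) • lcn lp lm t, lp, hF, ?_, lam, hlam, hnz,
    fun _ _ => rfl, fun _ _ => rfl⟩
  refine ⟨hF.smooth_base.add (hlam.smul hF.smooth_lp),
    (((hk.pow 2).smul hF.smooth_lp).add hF.smooth_lm).add
      ((contDiffOn_const.mul hk).smul (hF.smooth_lp.lcn hF.smooth_lm)),
    hF.smooth_lp, fun t ht => memDelta4_parabolic (hF.delta4 t ht) (k t), β,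
    fun t => α t + deriv lam t + lam t * κ₁ t - β t * k t ^ 2, hC.smooth_β, ?_,
    fun t ht => ?_⟩
  · exact ((hC.smooth_α.add (hlam.deriv_of_isOpen hI (by simp))).add
      (hlam.mul hC.smooth_κ₁)).sub (hC.smooth_β.mul (hk.pow 2))
  · rw [hC.deriv_add_smul_lp hI hF hlam ht, ← h t ht]
    module

/-- `(ℓ⁺,ℓ̄⁻)`-Bertrand lightcone framed curves: existence condition, and equivalence with
the `(ℓ⁺,ℓ̄⁺)`-Bertrand condition. -/
theorem bertrand_lp_lmbar
    (I : Set ℝ) (hIo : IsOpen I) (hIc : I.OrdConnected)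
    (γ lp lm : ℝ → Fin 3 → ℝ) (κ₁ κ₂ κ₃ α β : ℝ → ℝ)
    (hF : IsLightconeFramedCurve I γ lp lm)
    (hC : HasLightconeCurvature I γ lp lm κ₁ κ₂ κ₃ α β) :
    (IsBertrand I fieldLp fieldLm γ lp lm ↔
      ∃ lam k : ℝ → ℝ, Smooth1 I lam ∧ Smooth1 I k ∧ NotIdentZero I lam ∧
        ∀ t ∈ I, k t * β t = lam t * κ₃ t) ∧
    (IsBertrand I fieldLp fieldLp γ lp lm ↔ IsBertrand I fieldLp fieldLm γ lp lm) := by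
  exact ⟨⟨exists_of_isBertrand_lp_lm hIo hC, fun ⟨_, _, hlam, hk, hnz, h⟩ =>
    isBertrand_lp_lm_of_exists hIo hF hC hlam hk hnz h⟩, isBertrand_lp_lp_iff_lp_lm⟩
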